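/- Let H > 0, d ≥ 1, λ ∈ (0,1] and α ∈ (−1/(2H), 1/(2H)], and set γ = 5/8 + Hα/4 (so that γ > 1/2). There is a constant C depending only on H, d, λ and α such that for every continuous path w : [0,1] → ℝ^d with R^w_λ < ∞ and S^w_λ < ∞: K^w_{α,γ} ≤ C (1 + Q^w_λ). -/

import Mathlib

open MeasureTheory Filter Topology
open scoped ENNReal NNReal

noncomputable section

abbrev Euc (d : ℕ) : Type := EuclideanSpace ℝ (Fin d)

/-- `Y^w_{s,t}(ω,ξ) = ∫_s^t exp(i ξ·w_u + i ω u) du`. -/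
def Yint {d : ℕ} (w : ℝ → Euc d) (s t ω : ℝ) (ξ : Euc d) : ℂ :=
  ∫ u in s..t, Complex.exp (Complex.I * Complex.ofReal (inner ℝ ξ (w u) + ω * u))

/-- The averaging constant `K^w_{α,γ}`. -/
def avgK {d : ℕ} (w : ℝ → Euc d) (α γ : ℝ) : ℝ≥0∞ :=
  ⨆ (s : ℝ) (t : ℝ) (_ : 0 ≤ s) (_ : s < t) (_ : t ≤ 1) (ω : ℝ) (ξ : Euc d),
    ENNReal.ofReal (‖Yint w s t ω ξ‖ /
      ((1 + ‖ξ‖) ^ α * (1 + Real.sqrt (Real.log (1 + |ω|))) * (t - s) ^ γ))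

/-- The norm `N_α` of a space-time vector field given through its Fourier transform `bhat`. -/
def FLnorm (d : ℕ) (α : ℝ) (bhat : ℝ × Euc d → Fin d → ℂ) : ℝ≥0∞ :=
  ∫⁻ p : ℝ × Euc d, ENNReal.ofReal (‖bhat p‖ * (1 + ‖p.2‖) ^ α *
    (1 + Real.sqrt (Real.log (1 + |p.1|))))

/-- The vector field `b(t,x)` recovered from its space-time Fourier transform. -/
def fieldOf {d : ℕ} (bhat : ℝ × Euc d → Fin d → ℂ) (t : ℝ) (x : Euc d) : Euc d :=
  (EuclideanSpace.equiv (Fin d) ℝ).symm fun i =>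
    ∫ p : ℝ × Euc d, (bhat p i * Complex.exp (Complex.I * Complex.ofReal (p.1 * t + inner ℝ p.2 x))).re

/-- The averaged vector field `σ^w_{[s,t]} b`, defined through the Fourier representation. -/
def sigmaAvg {d : ℕ} (w : ℝ → Euc d) (bhat : ℝ × Euc d → Fin d → ℂ) (s t : ℝ) (x : Euc d) :
    Euc d :=
  (EuclideanSpace.equiv (Fin d) ℝ).symm fun i =>
    ∫ p : ℝ × Euc d, (bhat p i * Yint w s t p.1 p.2 *
      Complex.exp (Complex.I * Complex.ofReal (inner ℝ p.2 x))).re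

/-- Partitions of the interval `[s,t]`. -/
structure TimePartition (s t : ℝ) where
  n : ℕ
  pts : ℕ → ℝ
  first : pts 0 = s
  last : pts n = t
  mono : ∀ i, i < n → pts i ≤ pts (i + 1)

/-- The mesh of the partition is smaller than `δ`. -/
def TimePartition.MeshLt {s t : ℝ} (P : TimePartition s t) (δ : ℝ) : Prop :=
  ∀ i, i < P.n → P.pts (i + 1) - P.pts i < δ

/-- Riemann sums `Σ_i (G_{t_{i+1}} - G_{t_i})(f_{t_i})` of the nonlinear Young integral. -/
def RiemannSum {V W : Type*} [AddCommGroup W] (G : ℝ → V → W) (f : ℝ → V)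
    {s t : ℝ} (P : TimePartition s t) : W :=
  ∑ i ∈ Finset.range P.n, (G (P.pts (i + 1)) (f (P.pts i)) - G (P.pts i) (f (P.pts i)))

/-- `L` is the nonlinear Young integral `∫_s^t G_{du}(f_u)`: the Riemann sums converge to `L`
as the mesh of the partition tends to `0`. -/
def HasYoungIntegral {V W : Type*} [NormedAddCommGroup W] (G : ℝ → V → W) (f : ℝ → V)
    (s t : ℝ) (L : W) : Prop :=
  ∀ ε > 0, ∃ δ > 0, ∀ P : TimePartition s t, P.MeshLt δ → ‖RiemannSum G f P - L‖ < ε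

/-- Riemann sums `Σ_i (σ^w_{[t_i,t_{i+1}]} b)(θ_{t_i})`. -/
def sigmaRiemannSum {d : ℕ} (w : ℝ → Euc d) (bhat : ℝ × Euc d → Fin d → ℂ)
    (θ : ℝ → Euc d) {s t : ℝ} (P : TimePartition s t) : Euc d :=
  ∑ i ∈ Finset.range P.n, sigmaAvg w bhat (P.pts i) (P.pts (i + 1)) (θ (P.pts i))

/-- `L = ∫_s^t (σ^w_{du} b)(θ_u)` as a limit of Riemann sums. -/
def HasSigmaIntegral {d : ℕ} (w : ℝ → Euc d) (bhat : ℝ × Euc d → Fin d → ℂ)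
    (θ : ℝ → Euc d) (s t : ℝ) (L : Euc d) : Prop :=
  ∀ ε > 0, ∃ δ > 0, ∀ P : TimePartition s t, P.MeshLt δ → ‖sigmaRiemannSum w bhat θ P - L‖ < ε

/-- `θ` solves the Young equation `θ_t = x₀ + ∫_0^t (σ^w_{du} b)(θ_u)` on `[0,1]`. -/
def SolvesSigmaYoung {d : ℕ} (w : ℝ → Euc d) (bhat : ℝ × Euc d → Fin d → ℂ)
    (x₀ : Euc d) (θ : ℝ → Euc d) : Prop :=
  θ 0 = x₀ ∧ ∀ t ∈ Set.Icc (0 : ℝ) 1, HasSigmaIntegral w bhat θ 0 t (θ t - x₀)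

/-- `γ`-Hölder continuity on `[0,1]`. -/
def HolderOnIcc {E : Type*} [NormedAddCommGroup E] (γ : ℝ) (f : ℝ → E) : Prop :=
  ∃ C : ℝ, ∀ s ∈ Set.Icc (0 : ℝ) 1, ∀ t ∈ Set.Icc (0 : ℝ) 1, ‖f t - f s‖ ≤ C * |t - s| ^ γ

/-- Covariance of the fractional Brownian motion of Hurst index `H`. -/
def fbmCov (H : ℝ) (s t : ℝ) : ℝ := (s ^ (2 * H) + t ^ (2 * H) - |t - s| ^ (2 * H)) / 2

/-- `W` is a `d`-dimensional fractional Brownian motion of Hurst parameter `H` with continuous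
sample paths: the coordinates are independent centered Gaussian processes with the fBm
covariance, expressed by asking every finite linear combination to be Gaussian. -/
def IsFBM {Ω : Type*} [MeasureSpace Ω] (d : ℕ) (H : ℝ) (W : Ω → ℝ → Euc d) : Prop :=
  (∀ ω, ContinuousOn (W ω) (Set.Icc 0 1)) ∧
  (∀ t, Measurable fun ω => W ω t) ∧
  (∀ ω, W ω 0 = 0) ∧
  ∀ (n : ℕ) (c : Fin n → ℝ) (t : Fin n → ℝ) (j : Fin n → Fin d),
    (∀ k, t k ∈ Set.Icc (0 : ℝ) 1) →
    Measure.map (fun ω => ∑ k, c k * W ω (t k) (j k)) (volume : Measure Ω) =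
      ProbabilityTheory.gaussianReal 0
        (Real.toNNReal (∑ k, ∑ l, c k * c l *
          (if j k = j l then fbmCov H (t k) (t l) else 0)))

/-- `R^w_λ = (∫_0^1 exp(λ |w_u|²) du)^{1/λ}`. -/
def Rconst {d : ℕ} (lam : ℝ) (w : ℝ → Euc d) : ℝ≥0∞ :=
  (∫⁻ u in Set.Icc (0 : ℝ) 1, ENNReal.ofReal (Real.exp (lam * ‖w u‖ ^ 2))) ^ (1 / lam)

/-- `S^w_λ`. -/
def Sconst {d : ℕ} (H lam : ℝ) (w : ℝ → Euc d) : ℝ≥0∞ :=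
  (∑' n : ℕ, ∑' m : ℕ, ∑ k ∈ Finset.range (2 ^ n), ∑' q : ℤ × (Fin d → ℤ),
    ENNReal.ofReal (
      (2 : ℝ) ^ (-(2 * (n : ℝ)) - (m : ℝ) * ((d : ℝ) + 2)) *
      (1 + |(q.1 : ℝ) / 2 ^ m|) ^ (-(2 : ℝ)) *
      (1 + ‖(EuclideanSpace.equiv (Fin d) ℝ).symm (fun i => (q.2 i : ℝ) / 2 ^ m)‖) ^
        (-((d : ℝ) + 1)) *
      Real.exp (lam * 2 ^ n *
        (1 + ‖(EuclideanSpace.equiv (Fin d) ℝ).symm (fun i => (q.2 i : ℝ) / 2 ^ m)‖) ^ (1 / H) *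
        ‖Yint w ((k : ℝ) / 2 ^ n) (((k : ℝ) + 1) / 2 ^ n) ((q.1 : ℝ) / 2 ^ m)
          ((EuclideanSpace.equiv (Fin d) ℝ).symm (fun i => (q.2 i : ℝ) / 2 ^ m))‖ ^ 2))) ^
  (1 / lam)

/-- `Q^w_λ = √(log S^w_λ) + √(log R^w_λ)`. -/
def Qconst {d : ℕ} (H lam : ℝ) (w : ℝ → Euc d) : ℝ :=
  Real.sqrt (Real.log (Sconst H lam w).toReal) + Real.sqrt (Real.log (Rconst lam w).toReal)

/-- A continuous function on `[0,1]` whose dyadic increments decay like `2 ^ (-γ n)` is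
`γ`-Hölder. -/
theorem norm_sub_le_of_dyadic_increments {E : Type*} [NormedAddCommGroup E] {F : ℝ → E}
    {B γ : ℝ} (hγ : 0 < γ) (hF : ContinuousOn F (Set.Icc 0 1))
    (h : ∀ n k : ℕ, k < 2 ^ n →
      ‖F (((k : ℝ) + 1) / 2 ^ n) - F ((k : ℝ) / 2 ^ n)‖ ≤ B * ((2 : ℝ) ^ (-γ)) ^ n)
    {s t : ℝ} (hs : 0 ≤ s) (hst : s < t) (ht : t ≤ 1) :
    ‖F t - F s‖ ≤ B * ((1 + 2 / (1 - (2 : ℝ) ^ (-γ))) * 2 ^ γ) * (t - s) ^ γ := by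
  set r : ℝ := (2 : ℝ) ^ (-γ) with hr
  have hr0 : 0 < r := Real.rpow_pos_of_pos two_pos _
  have hr1 : r < 1 := Real.rpow_lt_one_of_one_lt_of_neg one_lt_two (by linarith)
  have hB : 0 ≤ B := by
    have := (norm_nonneg _).trans (h 0 0 (by norm_num))
    simpa using this
  have hp : ∀ n : ℕ, (0 : ℝ) < 2 ^ n := fun n => by positivity
  -- increments between neighbouring or equal dyadic points
  have step : ∀ n a b : ℕ, a ≤ b → b ≤ a + 1 → b ≤ 2 ^ n →
      dist (F ((a : ℝ) / 2 ^ n)) (F ((b : ℝ) / 2 ^ n)) ≤ B * r ^ n := by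
    intro n a b hab hba hb
    rcases hab.eq_or_lt with rfl | hlt
    · simp only [dist_self]; positivity
    · obtain rfl : b = a + 1 := by omega
      rw [dist_comm, dist_eq_norm]
      simpa using h n a (by omega)
  have floor_le : ∀ x : ℝ, x ≤ 1 → ∀ n : ℕ, ⌊x * 2 ^ n⌋₊ ≤ 2 ^ n := by
    intro x hx n
    have : ⌊x * 2 ^ n⌋₊ ≤ ⌊(2 : ℝ) ^ n⌋₊ :=
      Nat.floor_le_floor (by nlinarith [hp n])
    have h2 : ⌊(2 : ℝ) ^ n⌋₊ = 2 ^ n := by exact_mod_cast Nat.floor_natCast (R := ℝ) (2 ^ n)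
    omega
  have approx : ∀ x : ℝ, 0 ≤ x → x ≤ 1 → ∀ n : ℕ,
      dist (F ((⌊x * 2 ^ n⌋₊ : ℝ) / 2 ^ n)) (F x) ≤ B * r ^ n / (1 - r) := by
    intro x hx0 hx1 n
    refine dist_le_of_le_geometric_of_tendsto r B hr1
      (f := fun n : ℕ => F ((⌊x * 2 ^ n⌋₊ : ℝ) / 2 ^ n)) ?_ ?_ n
    · intro n
      have e : (⌊x * 2 ^ n⌋₊ : ℝ) / 2 ^ n = ((2 * ⌊x * 2 ^ n⌋₊ : ℕ) : ℝ) / 2 ^ (n + 1) := by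
        push_cast; rw [pow_succ]; field_simp
      have h1 := Nat.floor_le (mul_nonneg hx0 (hp n).le)
      have h2 := Nat.lt_floor_add_one (x * 2 ^ n)
      simp only [e]
      refine (step (n + 1) _ _ ?_ ?_ (floor_le x hx1 _)).trans ?_
      · apply Nat.le_floor; push_cast; rw [pow_succ]; linarith
      · apply Nat.le_of_lt_succ
        rw [Nat.floor_lt (by positivity)]
        push_cast; rw [pow_succ]; linarith
      · exact mul_le_mul_of_nonneg_left (pow_le_pow_of_le_one hr0.le hr1.le n.le_succ) hB
    · have hx : x ∈ Set.Icc (0 : ℝ) 1 := ⟨hx0, hx1⟩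
      refine (hF x hx).tendsto.comp (tendsto_nhdsWithin_iff.2 ⟨?_, ?_⟩)
      · have h0 : Tendsto (fun n : ℕ => (2 : ℝ) ^ n) atTop atTop :=
          tendsto_pow_atTop_atTop_of_one_lt one_lt_two
        exact (tendsto_nat_floor_mul_div_atTop hx0).comp h0
      · refine Eventually.of_forall fun n => ⟨by positivity, ?_⟩
        rw [div_le_one (hp n)]
        exact_mod_cast floor_le x hx1 n
  have hts : 0 < t - s := by linarith
  obtain ⟨n, hn1, hn2⟩ := exists_nat_pow_near_of_lt_one (y := (1 / 2 : ℝ)) hts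
    (by linarith) (by norm_num) (by norm_num)
  have hn2' : (t - s) * 2 ^ n ≤ 1 := by
    rw [one_div, inv_pow] at hn2
    calc (t - s) * 2 ^ n ≤ (2 ^ n)⁻¹ * 2 ^ n := by gcongr
      _ = 1 := inv_mul_cancel₀ (hp n).ne'
  have mid : dist (F ((⌊s * 2 ^ n⌋₊ : ℝ) / 2 ^ n)) (F ((⌊t * 2 ^ n⌋₊ : ℝ) / 2 ^ n)) ≤
      B * r ^ n := by
    refine step n _ _ (Nat.floor_le_floor (by gcongr)) ?_ (floor_le t ht n)
    rw [← Nat.floor_add_one (by positivity)]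
    exact Nat.floor_le_floor (by nlinarith)
  have hrn : r ^ n ≤ 2 ^ γ * (t - s) ^ γ := by
    rw [← Real.mul_rpow (by norm_num) hts.le, hr, Real.rpow_neg (by norm_num), inv_pow,
      ← Real.rpow_natCast, ← Real.rpow_mul (by norm_num), mul_comm γ,
      Real.rpow_mul (by norm_num), ← Real.inv_rpow (by positivity), Real.rpow_natCast]
    refine Real.rpow_le_rpow (by positivity) ?_ hγ.le
    rw [one_div, inv_pow, pow_succ, mul_inv] at hn1
    linarith
  have hs' := approx s hs (by linarith) n
  have ht' := approx t (by linarith) ht n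
  have tri := dist_triangle4 (F s) (F ((⌊s * 2 ^ n⌋₊ : ℝ) / 2 ^ n))
    (F ((⌊t * 2 ^ n⌋₊ : ℝ) / 2 ^ n)) (F t)
  rw [dist_comm (F s) (F ((⌊s * 2 ^ n⌋₊ : ℝ) / 2 ^ n))] at tri
  have h1r : 0 < 1 - r := by linarith
  calc ‖F t - F s‖ = dist (F s) (F t) := by rw [dist_comm, dist_eq_norm]
    _ ≤ B * r ^ n / (1 - r) + B * r ^ n + B * r ^ n / (1 - r) := by linarith
    _ = B * (1 + 2 / (1 - r)) * r ^ n := by ring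
    _ ≤ B * (1 + 2 / (1 - r)) * (2 ^ γ * (t - s) ^ γ) := by gcongr
    _ = B * ((1 + 2 / (1 - r)) * 2 ^ γ) * (t - s) ^ γ := by ring

theorem continuousOn_phase {d : ℕ} {w : ℝ → Euc d} (hw : ContinuousOn w (Set.Icc 0 1))
    (ω : ℝ) (ξ : Euc d) :
    ContinuousOn (fun u => Complex.exp (Complex.I * Complex.ofReal (inner ℝ ξ (w u) + ω * u)))
      (Set.Icc 0 1) := by
  have : ContinuousOn (fun u => inner ℝ ξ (w u) + ω * u) (Set.Icc (0 : ℝ) 1) :=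
    (continuousOn_const.inner hw).add (by fun_prop)
  exact Complex.continuous_exp.comp_continuousOn
    (continuousOn_const.mul (Complex.continuous_ofReal.comp_continuousOn this))

theorem intervalIntegrable_phase {d : ℕ} {w : ℝ → Euc d} (hw : ContinuousOn w (Set.Icc 0 1))
    (ω : ℝ) (ξ : Euc d) {s t : ℝ} (hs : s ∈ Set.Icc (0 : ℝ) 1) (ht : t ∈ Set.Icc (0 : ℝ) 1) :
    IntervalIntegrable
      (fun u => Complex.exp (Complex.I * Complex.ofReal (inner ℝ ξ (w u) + ω * u))) volume s t :=
  ((continuousOn_phase hw ω ξ).mono (Set.uIcc_subset_Icc hs ht)).intervalIntegrable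

theorem norm_Yint_le {d : ℕ} (w : ℝ → Euc d) (s t ω : ℝ) (ξ : Euc d) :
    ‖Yint w s t ω ξ‖ ≤ |t - s| := by
  have := intervalIntegral.norm_integral_le_of_norm_le_const (a := s) (b := t) (C := 1)
    (f := fun u => Complex.exp (Complex.I * Complex.ofReal (inner ℝ ξ (w u) + ω * u)))
    (fun u _ => by rw [Complex.norm_exp_I_mul_ofReal])
  simpa [Yint] using this

theorem Yint_sub_Yint {d : ℕ} {w : ℝ → Euc d} (hw : ContinuousOn w (Set.Icc 0 1))
    (ω : ℝ) (ξ : Euc d) {s t : ℝ} (hs : s ∈ Set.Icc (0 : ℝ) 1) (ht : t ∈ Set.Icc (0 : ℝ) 1) :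
    Yint w 0 t ω ξ - Yint w 0 s ω ξ = Yint w s t ω ξ := by
  have h0 : (0 : ℝ) ∈ Set.Icc (0 : ℝ) 1 := by simp
  exact intervalIntegral.integral_interval_sub_left (intervalIntegrable_phase hw ω ξ h0 ht)
    (intervalIntegrable_phase hw ω ξ h0 hs)

theorem continuousOn_Yint {d : ℕ} {w : ℝ → Euc d} (hw : ContinuousOn w (Set.Icc 0 1))
    (ω : ℝ) (ξ : Euc d) : ContinuousOn (fun t => Yint w 0 t ω ξ) (Set.Icc 0 1) := by
  refine (LipschitzOnWith.of_dist_le_mul (K := 1) fun t ht s hs => ?_).continuousOn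
  rw [dist_eq_norm, Yint_sub_Yint hw ω ξ hs ht, Real.dist_eq]
  simpa using norm_Yint_le w s t ω ξ

theorem norm_exp_I_mul_sub_exp_I_mul_le (a b : ℝ) :
    ‖Complex.exp (Complex.I * Complex.ofReal a) - Complex.exp (Complex.I * Complex.ofReal b)‖ ≤
      |a - b| := by
  have e : Complex.exp (Complex.I * Complex.ofReal a) - Complex.exp (Complex.I * Complex.ofReal b)
      = Complex.exp (Complex.I * Complex.ofReal b) *
        (Complex.exp (Complex.I * Complex.ofReal (a - b)) - 1) := by
    rw [mul_sub, ← Complex.exp_add, mul_one]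
    congr 2
    push_cast; ring
  rw [e, norm_mul, Complex.norm_exp_I_mul_ofReal, one_mul]
  simpa using Real.norm_exp_I_mul_ofReal_sub_one_le (x := a - b)

/-- `Y` is Lipschitz in the frequency variables, with constants controlled by the length of the
time interval and by the `L²` norm of the path. -/
theorem norm_Yint_sub_Yint_le {d : ℕ} {w : ℝ → Euc d} (hw : ContinuousOn w (Set.Icc 0 1))
    {s t : ℝ} (hs : 0 ≤ s) (hst : s ≤ t) (ht : t ≤ 1) (ω ω' : ℝ) (ξ ξ' : Euc d)
    {c : ℝ} (hc : 0 < c) :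
    ‖Yint w s t ω ξ - Yint w s t ω' ξ'‖ ≤ |ω - ω'| * (t - s) +
      ‖ξ - ξ'‖ * (c * (t - s) + (∫ u in (0 : ℝ)..1, ‖w u‖ ^ 2) / c) := by
  have hs1 : s ∈ Set.Icc (0 : ℝ) 1 := ⟨hs, hst.trans ht⟩
  have ht1 : t ∈ Set.Icc (0 : ℝ) 1 := ⟨hs.trans hst, ht⟩
  have hw2 : ContinuousOn (fun u => ‖w u‖ ^ 2) (Set.Icc (0 : ℝ) 1) := hw.norm.pow 2
  have hsub : Set.uIcc s t ⊆ Set.Icc (0 : ℝ) 1 := Set.uIcc_subset_Icc hs1 ht1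
  have hi2 : IntervalIntegrable (fun u => ‖w u‖ ^ 2) volume s t :=
    (hw2.mono hsub).intervalIntegrable
  have hi01 : IntervalIntegrable (fun u => ‖w u‖ ^ 2) volume 0 1 :=
    (hw2.mono (by rw [Set.uIcc_of_le zero_le_one])).intervalIntegrable
  have hmono : ∫ u in s..t, ‖w u‖ ^ 2 ≤ ∫ u in (0 : ℝ)..1, ‖w u‖ ^ 2 :=
    intervalIntegral.integral_mono_interval hs hst ht
      (Eventually.of_forall fun u => by positivity) hi01
  have hpt : ∀ u ∈ Set.Icc (0 : ℝ) 1,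
      ‖Complex.exp (Complex.I * Complex.ofReal (inner ℝ ξ (w u) + ω * u)) -
        Complex.exp (Complex.I * Complex.ofReal (inner ℝ ξ' (w u) + ω' * u))‖ ≤
      |ω - ω'| + ‖ξ - ξ'‖ * (c + ‖w u‖ ^ 2 / c) := by
    intro u hu
    refine (norm_exp_I_mul_sub_exp_I_mul_le _ _).trans ?_
    have e : inner ℝ ξ (w u) + ω * u - (inner ℝ ξ' (w u) + ω' * u) =
        (ω - ω') * u + inner ℝ (ξ - ξ') (w u) := by rw [inner_sub_left]; ring
    rw [e]
    refine (abs_add_le _ _).trans (add_le_add ?_ ?_)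
    · rw [abs_mul, abs_of_nonneg hu.1]
      exact mul_le_of_le_one_right (abs_nonneg _) hu.2
    · refine (abs_real_inner_le_norm _ _).trans (mul_le_mul_of_nonneg_left ?_ (norm_nonneg _))
      rw [← sub_nonneg]
      have : c + ‖w u‖ ^ 2 / c - ‖w u‖ = ((c - ‖w u‖ / 2) ^ 2 + 3 / 4 * ‖w u‖ ^ 2) / c := by
        field_simp; ring
      rw [this]; positivity
  unfold Yint
  rw [← intervalIntegral.integral_sub (intervalIntegrable_phase hw ω ξ hs1 ht1)
    (intervalIntegrable_phase hw ω' ξ' hs1 ht1)]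
  have hib : IntervalIntegrable (fun u => |ω - ω'| + ‖ξ - ξ'‖ * (c + ‖w u‖ ^ 2 / c))
      volume s t :=
    intervalIntegrable_const.add ((intervalIntegrable_const.add (hi2.div_const c)).const_mul _)
  refine (intervalIntegral.norm_integral_le_of_norm_le hst
    (Eventually.of_forall fun u hu => hpt u ?_) hib).trans ?_
  · exact ⟨hs.trans hu.1.le, hu.2.trans ht⟩
  · rw [intervalIntegral.integral_add intervalIntegrable_const
      ((intervalIntegrable_const.add (hi2.div_const c)).const_mul _),
      intervalIntegral.integral_const_mul,
      intervalIntegral.integral_add intervalIntegrable_const (hi2.div_const c),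
      intervalIntegral.integral_div]
    simp only [intervalIntegral.integral_const, smul_eq_mul]
    rw [mul_comm (t - s) |ω - ω'|, mul_comm (t - s) c]
    gcongr

theorem integral_norm_sq_le_log_Rconst {d : ℕ} {lam : ℝ} (hlam : 0 < lam) {w : ℝ → Euc d}
    (hw : ContinuousOn w (Set.Icc 0 1)) :
    ∫ u in (0 : ℝ)..1, ‖w u‖ ^ 2 ≤ Real.log (Rconst lam w).toReal := by
  set f : ℝ → ℝ := fun u => lam * ‖w u‖ ^ 2 with hf
  have hfc : ContinuousOn f (Set.Icc 0 1) := continuousOn_const.mul (hw.norm.pow 2)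
  have hec : ContinuousOn (fun u => Real.exp (f u)) (Set.Icc 0 1) :=
    Real.continuous_exp.comp_continuousOn hfc
  have hU : Set.uIcc (0 : ℝ) 1 = Set.Icc 0 1 := Set.uIcc_of_le zero_le_one
  have hfi : IntervalIntegrable f volume 0 1 := (hU ▸ hfc).intervalIntegrable
  have hei : IntervalIntegrable (fun u => Real.exp (f u)) volume 0 1 :=
    (hU ▸ hec).intervalIntegrable
  set Z : ℝ := ∫ u in (0 : ℝ)..1, Real.exp (f u) with hZ
  have hZpos : 0 < Z := intervalIntegral.intervalIntegral_pos_of_pos hei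
    (fun u => Real.exp_pos _) zero_lt_one
  have hR : Real.log (Rconst lam w).toReal = Real.log Z / lam := by
    have hl : ∫⁻ u in Set.Icc (0 : ℝ) 1, ENNReal.ofReal (Real.exp (lam * ‖w u‖ ^ 2)) =
        ENNReal.ofReal Z := by
      rw [hZ, intervalIntegral.integral_of_le zero_le_one, ← integral_Icc_eq_integral_Ioc,
        ofReal_integral_eq_lintegral_ofReal hec.integrableOn_Icc
          (Eventually.of_forall fun u => (Real.exp_pos _).le)]
    rw [Rconst, hl, ← ENNReal.toReal_rpow, ENNReal.toReal_ofReal hZpos.le, Real.log_rpow hZpos]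
    ring
  have key : ∫ u in (0 : ℝ)..1, (f u - Real.log Z + 1) ≤
      ∫ u in (0 : ℝ)..1, Real.exp (f u) / Z := by
    refine intervalIntegral.integral_mono_on zero_le_one
      ((hfi.sub intervalIntegrable_const).add intervalIntegrable_const) (hei.div_const Z)
      fun u _ => ?_
    have := Real.add_one_le_exp (f u - Real.log Z)
    rwa [Real.exp_sub, Real.exp_log hZpos] at this
  rw [intervalIntegral.integral_div, ← hZ, div_self hZpos.ne',
    intervalIntegral.integral_add (hfi.sub intervalIntegrable_const) intervalIntegrable_const,
    intervalIntegral.integral_sub hfi intervalIntegrable_const, hf,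
    intervalIntegral.integral_const_mul] at key
  simp only [intervalIntegral.integral_const, smul_eq_mul, sub_zero, one_mul] at key
  rw [hR, le_div_iff₀ hlam]
  linarith

/-- Every single term of the series defining `S` gives an exponential bound on `Y` at a dyadic
point. -/
theorem sq_norm_Yint_grid_le {d : ℕ} {H lam : ℝ} (hlam : 0 < lam) {w : ℝ → Euc d}
    (hS : Sconst H lam w < ⊤) {n k : ℕ} (hk : k < 2 ^ n) (m : ℕ) (j : ℤ) (l : Fin d → ℤ)
    {ω : ℝ} {ξ : Euc d} (hω : ω = (j : ℝ) / 2 ^ m)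
    (hξ : ξ = (EuclideanSpace.equiv (Fin d) ℝ).symm (fun i => (l i : ℝ) / 2 ^ m)) :
    lam * 2 ^ n * (1 + ‖ξ‖) ^ (1 / H) *
        ‖Yint w ((k : ℝ) / 2 ^ n) (((k : ℝ) + 1) / 2 ^ n) ω ξ‖ ^ 2 ≤
      lam * Real.log (Sconst H lam w).toReal + (2 * n + m * (d + 2)) * Real.log 2 +
        2 * Real.log (1 + |ω|) + (d + 1) * Real.log (1 + ‖ξ‖) := by
  set Z : ℝ≥0∞ := ∑' n : ℕ, ∑' m : ℕ, ∑ k ∈ Finset.range (2 ^ n), ∑' q : ℤ × (Fin d → ℤ),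
    ENNReal.ofReal (
      (2 : ℝ) ^ (-(2 * (n : ℝ)) - (m : ℝ) * ((d : ℝ) + 2)) *
      (1 + |(q.1 : ℝ) / 2 ^ m|) ^ (-(2 : ℝ)) *
      (1 + ‖(EuclideanSpace.equiv (Fin d) ℝ).symm (fun i => (q.2 i : ℝ) / 2 ^ m)‖) ^
        (-((d : ℝ) + 1)) *
      Real.exp (lam * 2 ^ n *
        (1 + ‖(EuclideanSpace.equiv (Fin d) ℝ).symm (fun i => (q.2 i : ℝ) / 2 ^ m)‖) ^ (1 / H) *
        ‖Yint w ((k : ℝ) / 2 ^ n) (((k : ℝ) + 1) / 2 ^ n) ((q.1 : ℝ) / 2 ^ m)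
          ((EuclideanSpace.equiv (Fin d) ℝ).symm (fun i => (q.2 i : ℝ) / 2 ^ m))‖ ^ 2)) with hZ
  have hSZ : Sconst H lam w = Z ^ (1 / lam) := rfl
  have hZtop : Z ≠ ⊤ := by
    intro h
    rw [hSZ, h, ENNReal.top_rpow_of_pos (by positivity)] at hS
    exact lt_irrefl _ hS
  set E : ℝ := lam * 2 ^ n * (1 + ‖ξ‖) ^ (1 / H) *
    ‖Yint w ((k : ℝ) / 2 ^ n) (((k : ℝ) + 1) / 2 ^ n) ω ξ‖ ^ 2 with hE
  set T : ℝ := (2 : ℝ) ^ (-(2 * (n : ℝ)) - (m : ℝ) * ((d : ℝ) + 2)) *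
    (1 + |ω|) ^ (-(2 : ℝ)) * (1 + ‖ξ‖) ^ (-((d : ℝ) + 1)) * Real.exp E with hT
  have hTZ : ENNReal.ofReal T ≤ Z := by
    rw [hZ]
    refine le_trans ?_ (ENNReal.le_tsum n)
    refine le_trans ?_ (ENNReal.le_tsum m)
    refine le_trans ?_ (Finset.single_le_sum (fun _ _ => zero_le) (Finset.mem_range.2 hk))
    refine le_trans (le_of_eq ?_) (ENNReal.le_tsum (j, l))
    rw [hT, hE, hω, hξ]
  have hω0 : 0 < 1 + |ω| := by positivity
  have hξ0 : 0 < 1 + ‖ξ‖ := by positivity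
  have hTpos : 0 < T := by positivity
  have hTZ' : T ≤ Z.toReal := (ENNReal.ofReal_le_iff_le_toReal hZtop).1 hTZ
  have hlogS : lam * Real.log (Sconst H lam w).toReal = Real.log Z.toReal := by
    rw [hSZ, ← ENNReal.toReal_rpow, Real.log_rpow (hTpos.trans_le hTZ')]
    field_simp
  have hlogT : Real.log T = (-(2 * (n : ℝ)) - (m : ℝ) * ((d : ℝ) + 2)) * Real.log 2 +
      -2 * Real.log (1 + |ω|) + -((d : ℝ) + 1) * Real.log (1 + ‖ξ‖) + E := by
    rw [hT, Real.log_mul (by positivity) (by positivity),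
      Real.log_mul (by positivity) (by positivity), Real.log_mul (by positivity) (by positivity),
      Real.log_rpow two_pos, Real.log_rpow hω0, Real.log_rpow hξ0, Real.log_exp]
  have := Real.log_le_log hTpos hTZ'
  rw [hlogT, ← hlogS] at this
  linarith

theorem norm_le_card_mul_of_abs_le {d : ℕ} {x : Euc d} {ε : ℝ} (hε : 0 ≤ ε)
    (h : ∀ i, |x i| ≤ ε) : ‖x‖ ≤ d * ε := by
  rw [EuclideanSpace.norm_eq]
  apply Real.sqrt_le_iff.2 ⟨by positivity, ?_⟩
  have hd : (d : ℝ) ≤ (d : ℝ) ^ 2 := by exact_mod_cast Nat.le_self_pow two_ne_zero d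
  calc ∑ i, ‖x i‖ ^ 2 ≤ ∑ _i : Fin d, ε ^ 2 :=
        Finset.sum_le_sum fun i _ => by
          rw [Real.norm_eq_abs]; exact pow_le_pow_left₀ (abs_nonneg _) (h i) 2
    _ = d * ε ^ 2 := by simp
    _ ≤ d ^ 2 * ε ^ 2 := by gcongr
    _ = (d * ε) ^ 2 := by ring

theorem abs_sub_floor_div_le (x : ℝ) (m : ℕ) : |x - (⌊x * 2 ^ m⌋ : ℝ) / 2 ^ m| ≤ (2 ^ m)⁻¹ := by
  have hp : (0 : ℝ) < 2 ^ m := by positivity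
  have e : x - (⌊x * 2 ^ m⌋ : ℝ) / 2 ^ m = Int.fract (x * 2 ^ m) / 2 ^ m := by
    rw [Int.fract]; field_simp
  rw [e, abs_of_nonneg (div_nonneg (Int.fract_nonneg _) hp.le), inv_eq_one_div]
  exact div_le_div_of_nonneg_right (Int.fract_lt_one _).le hp.le

theorem exists_rpow_le_two_pow {X p : ℝ} (hX : 1 ≤ X) (hp : 0 ≤ p) :
    ∃ m : ℕ, X ^ p ≤ 2 ^ m ∧ m * Real.log 2 ≤ 1 + p * Real.log X := by
  have hlX : 0 ≤ Real.log X := Real.log_nonneg hX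
  have hl2 : 0 < Real.log 2 := Real.log_pos one_lt_two
  have hl21 : Real.log 2 ≤ 1 := by linarith [Real.log_two_lt_d9]
  have h0 : 0 ≤ p * Real.log X / Real.log 2 := by positivity
  refine ⟨⌈p * Real.log X / Real.log 2⌉₊, ?_, ?_⟩
  · rw [← Real.log_le_log_iff (by positivity) (by positivity), Real.log_rpow (by linarith),
      Real.log_pow]
    exact (div_le_iff₀ hl2).1 (Nat.le_ceil _)
  · have := mul_le_mul_of_nonneg_right (Nat.ceil_lt_add_one h0).le hl2.le
    rw [add_mul, div_mul_cancel₀ _ hl2.ne'] at this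
    linarith

set_option maxHeartbeats 800000 in
/-- The bound on `Y` over dyadic intervals coming from the exponential moments. -/
theorem exists_norm_Yint_dyadic_le (d : ℕ) {H lam : ℝ} (hH : 0 < H) (hlam : 0 < lam) :
    ∃ C : ℝ, 1 ≤ C ∧ ∀ w : ℝ → Euc d, ContinuousOn w (Set.Icc 0 1) → Sconst H lam w < ⊤ →
      ∀ n k : ℕ, k < 2 ^ n → ∀ (ω : ℝ) (ξ : Euc d),
        ‖Yint w ((k : ℝ) / 2 ^ n) (((k : ℝ) + 1) / 2 ^ n) ω ξ‖ ≤
          C * ((1 + Qconst H lam w) * (1 + √(Real.log (1 + |ω|))) * √(1 + n) *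
            √(1 + Real.log (1 + ‖ξ‖))) *
            ((2 : ℝ) ^ (-(n : ℝ) / 2) * (1 + ‖ξ‖) ^ (-(1 / (2 * H)))) := by
  set p : ℝ := 1 / (2 * H) with hp
  have hp0 : 0 < p := by positivity
  set A : ℝ := lam + 2 + (d + 2) * (1 + p) + 2 + (d + 1) ^ 2 with hA
  have hA0 : 0 < A := by positivity
  set A' : ℝ := A / lam * (1 + d) ^ (1 / H) with hA'
  have hApos' : 0 < A' := by positivity
  refine ⟨√A' + (1 + 2 * d), by have := Real.sqrt_nonneg A'; linarith [d.cast_nonneg (α := ℝ)],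
    fun w hw hS n k hk ω ξ => ?_⟩
  set X : ℝ := 1 + ‖ξ‖ with hX
  have hX1 : 1 ≤ X := by linarith [norm_nonneg ξ]
  have hX0 : 0 < X := by linarith
  set G : ℝ := 1 + Qconst H lam w with hG
  set W : ℝ := 1 + √(Real.log (1 + |ω|)) with hW
  set N : ℝ := 1 + (n : ℝ) with hN
  set L : ℝ := 1 + Real.log X with hL
  set P : ℝ := G * W * √N * √L with hP
  set a : ℝ := (2 : ℝ) ^ (-(n : ℝ) / 2) with ha
  have ha0 : 0 < a := by positivity
  have ha2 : a ^ 2 * 2 ^ n = 1 := by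
    rw [ha, ← Real.rpow_natCast, ← Real.rpow_mul two_pos.le, ← Real.rpow_natCast 2 n,
      ← Real.rpow_add two_pos]
    norm_num
  have hsS := Real.sqrt_nonneg (Real.log (Sconst H lam w).toReal)
  have hsR := Real.sqrt_nonneg (Real.log (Rconst lam w).toReal)
  have hsω := Real.sqrt_nonneg (Real.log (1 + |ω|))
  have hlX : 0 ≤ Real.log X := Real.log_nonneg hX1
  have hlω : 0 ≤ Real.log (1 + |ω|) := Real.log_nonneg (by linarith [abs_nonneg ω])
  have hG1 : 1 ≤ G := by rw [hG, Qconst]; linarith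
  have hW1 : 1 ≤ W := by linarith
  have hN1 : 1 ≤ N := by linarith [n.cast_nonneg (α := ℝ)]
  have hL1 : 1 ≤ L := by linarith
  have hsqrt : ∀ x : ℝ, x ≤ √x ^ 2 := fun x => by
    rcases le_total 0 x with h | h
    · rw [Real.sq_sqrt h]
    · exact h.trans (sq_nonneg _)
  have hlogS : Real.log (Sconst H lam w).toReal ≤ G ^ 2 :=
    (hsqrt _).trans (pow_le_pow_left₀ hsS (by rw [hG, Qconst]; linarith) 2)
  have hlogR : Real.log (Rconst lam w).toReal ≤ G ^ 2 :=
    (hsqrt _).trans (pow_le_pow_left₀ hsR (by rw [hG, Qconst]; linarith) 2)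
  have hW2 : 1 + Real.log (1 + |ω|) ≤ W ^ 2 := by
    linarith [Real.sq_sqrt hlω, add_sq 1 √(Real.log (1 + |ω|))]
  have hG2 : 1 ≤ G ^ 2 := one_le_pow₀ hG1
  have hW21 : 1 ≤ W ^ 2 := one_le_pow₀ hW1
  have hP2 : P ^ 2 = G ^ 2 * W ^ 2 * N * L := by
    rw [hP, mul_pow, mul_pow, mul_pow, Real.sq_sqrt (by linarith), Real.sq_sqrt (by linarith)]
  have hGP2 : G ^ 2 ≤ P ^ 2 := by
    rw [hP2, mul_assoc, mul_assoc]
    exact le_mul_of_one_le_right (by positivity) (one_le_mul_of_one_le_of_one_le hW21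
      (one_le_mul_of_one_le_of_one_le hN1 hL1))
  have hWP2 : W ^ 2 ≤ P ^ 2 := by
    rw [hP2, mul_comm (G ^ 2), mul_assoc, mul_assoc]
    exact le_mul_of_one_le_right (by positivity) (one_le_mul_of_one_le_of_one_le hG2
      (one_le_mul_of_one_le_of_one_le hN1 hL1))
  have hNP2 : N ≤ P ^ 2 := by
    rw [hP2, mul_comm (G ^ 2 * W ^ 2), mul_assoc]
    exact le_mul_of_one_le_right (by positivity) (one_le_mul_of_one_le_of_one_le
      (one_le_mul_of_one_le_of_one_le hG2 hW21) hL1)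
  have hLP2 : L ≤ P ^ 2 := by
    rw [hP2]
    exact le_mul_of_one_le_left (by positivity) (one_le_mul_of_one_le_of_one_le
      (one_le_mul_of_one_le_of_one_le hG2 hW21) hN1)
  have hP0 : 0 ≤ P := by positivity
  have hGP : G ≤ P := (pow_le_pow_iff_left₀ (by linarith) hP0 two_ne_zero).1 hGP2
  obtain ⟨m, hm1, hm2⟩ := exists_rpow_le_two_pow hX1 hp0.le
  have hpm1 : ((2 : ℝ) ^ m)⁻¹ ≤ 1 := inv_le_one_of_one_le₀ (one_le_pow₀ one_le_two)
  obtain ⟨ω', hω'⟩ : ∃ ω' : ℝ, ω' = (⌊ω * 2 ^ m⌋ : ℝ) / 2 ^ m := ⟨_, rfl⟩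
  obtain ⟨ξ', hξ'⟩ : ∃ ξ' : Euc d, ξ' = (EuclideanSpace.equiv (Fin d) ℝ).symm
    (fun i => (⌊ξ i * 2 ^ m⌋ : ℝ) / 2 ^ m) := ⟨_, rfl⟩
  have hωω : |ω - ω'| ≤ (2 ^ m)⁻¹ := hω' ▸ abs_sub_floor_div_le ω m
  have hξξ : ‖ξ - ξ'‖ ≤ d * (2 ^ m)⁻¹ := norm_le_card_mul_of_abs_le (by positivity) fun i => by
    rw [hξ']
    simpa using abs_sub_floor_div_le (ξ i) m
  have hξξ1 : ‖ξ - ξ'‖ ≤ d := hξξ.trans (mul_le_of_le_one_right (by positivity) hpm1)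
  have hd0 : (0 : ℝ) ≤ d := d.cast_nonneg
  have hXX' : X ≤ (1 + d) * (1 + ‖ξ'‖) := by
    have := norm_le_norm_add_norm_sub' ξ ξ'
    linarith [mul_nonneg hd0 (norm_nonneg ξ')]
  have hX'X : 1 + ‖ξ'‖ ≤ (1 + d) * X := by
    have := norm_le_norm_add_norm_sub ξ ξ'
    linarith [mul_nonneg hd0 (norm_nonneg ξ)]
  have hlX' : Real.log (1 + ‖ξ'‖) ≤ (d + 1) * L := by
    have h1 := Real.log_le_log (by positivity) hX'X
    rw [Real.log_mul (by positivity) hX0.ne'] at h1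
    have h2 := Real.log_le_sub_one_of_pos (show (0 : ℝ) < 1 + d by positivity)
    linarith [mul_nonneg hd0 hlX]
  have hlω' : Real.log (1 + |ω'|) ≤ W ^ 2 := by
    have h0 : |ω'| ≤ |ω| + 1 := by
      have := abs_sub_abs_le_abs_sub ω' ω
      rw [abs_sub_comm] at this
      linarith
    have h1 : Real.log (1 + |ω'|) ≤ Real.log (2 * (1 + |ω|)) :=
      Real.log_le_log (by positivity) (by linarith [abs_nonneg ω])
    rw [Real.log_mul two_ne_zero (by positivity)] at h1
    linarith [Real.log_two_lt_d9]
  set y' : ℝ := ‖Yint w ((k : ℝ) / 2 ^ n) (((k : ℝ) + 1) / 2 ^ n) ω' ξ'‖ with hy'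
  have hterm := sq_norm_Yint_grid_le hlam hS hk m _ _ hω' hξ'
  rw [← hy'] at hterm
  have hbr : lam * 2 ^ n * (1 + ‖ξ'‖) ^ (1 / H) * y' ^ 2 ≤ A * P ^ 2 := by
    refine hterm.trans ?_
    have h1 : lam * Real.log (Sconst H lam w).toReal ≤ lam * P ^ 2 := by
      gcongr; exact hlogS.trans hGP2
    have h2 : 2 * (n : ℝ) * Real.log 2 ≤ 2 * P ^ 2 := by
      have : (n : ℝ) * Real.log 2 ≤ n :=
        mul_le_of_le_one_right n.cast_nonneg (by linarith [Real.log_two_lt_d9])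
      linarith
    have h3 : m * Real.log 2 ≤ (1 + p) * P ^ 2 := by
      have : 1 + p * Real.log X ≤ (1 + p) * L := by linarith
      exact hm2.trans (this.trans (by gcongr))
    have h4 : (d + 2 : ℝ) * (m * Real.log 2) ≤ (d + 2) * ((1 + p) * P ^ 2) := by gcongr
    have h5 : Real.log (1 + |ω'|) ≤ P ^ 2 := hlω'.trans hWP2
    have h6 : (d + 1 : ℝ) * Real.log (1 + ‖ξ'‖) ≤ (d + 1) * ((d + 1) * P ^ 2) := by
      gcongr; exact hlX'.trans (by gcongr)
    rw [hA]; linarith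
  have hXH : X ^ (1 / H) ≤ (1 + d) ^ (1 / H) * (1 + ‖ξ'‖) ^ (1 / H) := by
    rw [← Real.mul_rpow (by positivity) (by positivity)]
    exact Real.rpow_le_rpow hX0.le hXX' (by positivity)
  have hXp : (X ^ (-p)) ^ 2 * X ^ (1 / H) = 1 := by
    rw [← Real.rpow_natCast, ← Real.rpow_mul hX0.le, ← Real.rpow_add hX0]
    have : -p * ((2 : ℕ) : ℝ) + 1 / H = 0 := by rw [hp]; push_cast; field_simp; ring
    rw [this, Real.rpow_zero]
  have hXp0 : 0 < X ^ (-p) := Real.rpow_pos_of_pos hX0 _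
  have hE : 2 ^ n * X ^ (1 / H) * y' ^ 2 ≤ A' * P ^ 2 := by
    calc 2 ^ n * X ^ (1 / H) * y' ^ 2
        ≤ 2 ^ n * ((1 + d) ^ (1 / H) * (1 + ‖ξ'‖) ^ (1 / H)) * y' ^ 2 := by gcongr
      _ = (1 + d) ^ (1 / H) / lam * (lam * 2 ^ n * (1 + ‖ξ'‖) ^ (1 / H) * y' ^ 2) := by
          field_simp
      _ ≤ (1 + d) ^ (1 / H) / lam * (A * P ^ 2) := by gcongr
      _ = A' * P ^ 2 := by rw [hA']; ring
  have hy'le : y' ≤ √A' * P * (a * X ^ (-p)) := by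
    rw [← pow_le_pow_iff_left₀ (norm_nonneg _) (by positivity) two_ne_zero]
    calc y' ^ 2 = (a ^ 2 * 2 ^ n) * ((X ^ (-p)) ^ 2 * X ^ (1 / H)) * y' ^ 2 := by
          rw [ha2, hXp]; ring
      _ = a ^ 2 * (X ^ (-p)) ^ 2 * (2 ^ n * X ^ (1 / H) * y' ^ 2) := by ring
      _ ≤ a ^ 2 * (X ^ (-p)) ^ 2 * (A' * P ^ 2) := by gcongr
      _ = (√A' * P * (a * X ^ (-p))) ^ 2 := by
          rw [mul_pow (√A' * P), mul_pow √A', Real.sq_sqrt hApos'.le]; ring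
  have hpn : (0 : ℝ) < 2 ^ n := by positivity
  have hlen : ((k : ℝ) + 1) / 2 ^ n - (k : ℝ) / 2 ^ n = a ^ 2 := by
    rw [← sub_div, add_sub_cancel_left, div_eq_iff hpn.ne', ha2]
  have ha1 : a ≤ 1 := by
    refine Real.rpow_le_one_of_one_le_of_nonpos one_le_two ?_
    have : (0 : ℝ) ≤ n := n.cast_nonneg
    linarith
  have hdiff := norm_Yint_sub_Yint_le hw (s := (k : ℝ) / 2 ^ n) (t := ((k : ℝ) + 1) / 2 ^ n)
    (by positivity) (by gcongr; linarith) (by rw [div_le_one hpn]; exact_mod_cast hk)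
    ω ω' ξ ξ' (c := G / a) (by positivity)
  rw [hlen] at hdiff
  have hR := (integral_norm_sq_le_log_Rconst hlam hw).trans hlogR
  have hI0 : 0 ≤ ∫ u in (0 : ℝ)..1, ‖w u‖ ^ 2 :=
    intervalIntegral.integral_nonneg zero_le_one fun u _ => by positivity
  have hXm : ((2 : ℝ) ^ m)⁻¹ ≤ X ^ (-p) := by
    rw [Real.rpow_neg hX0.le]
    exact inv_anti₀ (Real.rpow_pos_of_pos hX0 _) hm1
  have hdiff' : ‖Yint w ((k : ℝ) / 2 ^ n) (((k : ℝ) + 1) / 2 ^ n) ω ξ -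
      Yint w ((k : ℝ) / 2 ^ n) (((k : ℝ) + 1) / 2 ^ n) ω' ξ'‖ ≤
      (1 + 2 * d) * P * (a * X ^ (-p)) := by
    refine hdiff.trans ?_
    calc |ω - ω'| * a ^ 2 + ‖ξ - ξ'‖ * (G / a * a ^ 2 +
          (∫ u in (0 : ℝ)..1, ‖w u‖ ^ 2) / (G / a))
        ≤ X ^ (-p) * (a * G) + d * X ^ (-p) * (G / a * a ^ 2 + G ^ 2 / (G / a)) := by
          gcongr
          · exact hωω.trans hXm
          · rw [sq]; exact mul_le_mul_of_nonneg_left (ha1.trans hG1) ha0.le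
          · exact hξξ.trans (by gcongr)
      _ = (1 + 2 * d) * G * (a * X ^ (-p)) := by field_simp; ring
      _ ≤ (1 + 2 * d) * P * (a * X ^ (-p)) := by gcongr
  have := norm_le_norm_add_norm_sub' (Yint w ((k : ℝ) / 2 ^ n) (((k : ℝ) + 1) / 2 ^ n) ω ξ)
    (Yint w ((k : ℝ) / 2 ^ n) (((k : ℝ) + 1) / 2 ^ n) ω' ξ')
  rw [← hy'] at this
  linarith

/-- Interpolation of the trivial bound `2 ^ (-n)` with the bound of order
`2 ^ (-n / 2) X ^ (-p)`; the logarithmic factors are absorbed by the slack in the exponents. -/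
theorem interpolated_decay_le {y C G W X p δ : ℝ} {n : ℕ} (hX : 1 ≤ X) (hp : 0 < p)
    (hδ : 0 < δ) (hδ1 : δ ≤ 1) (hy : 0 ≤ y) (hC : 1 ≤ C) (hG : 1 ≤ G) (hW : 1 ≤ W)
    (h1 : y ≤ 1 / 2 ^ n)
    (h2 : y ≤ C * (G * W * √(1 + n) * √(1 + Real.log X)) * ((2 : ℝ) ^ (-(n : ℝ) / 2) * X ^ (-p))) :
    y ≤ C * √(1 + 4 / δ) * √(1 + 1 / (2 * p * δ)) * G * W * X ^ (p * δ + -p * (1 - δ)) *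
      (2 : ℝ) ^ (-(1 / 2 + δ / 4) * n) := by
  have hX0 : 0 < X := by linarith
  have hlX : 0 ≤ Real.log X := Real.log_nonneg hX
  have hn0 : (0 : ℝ) ≤ n := n.cast_nonneg
  have hN : √(1 + n) ≤ √(1 + 4 / δ) * (2 : ℝ) ^ (n * δ / 4) := by
    apply Real.sqrt_le_iff.2 ⟨by positivity, ?_⟩
    rw [mul_pow, Real.sq_sqrt (by positivity), ← Real.rpow_natCast, ← Real.rpow_mul two_pos.le,
      Real.rpow_def_of_pos two_pos]
    have hexp := Real.add_one_le_exp (Real.log 2 * (n * δ / 4 * ((2 : ℕ) : ℝ)))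
    have hlog : (n * δ / 4 : ℝ) ≤ Real.log 2 * (n * δ / 4 * ((2 : ℕ) : ℝ)) := by
      have : (0 : ℝ) ≤ n * δ / 4 := by positivity
      push_cast
      nlinarith [Real.log_two_gt_d9]
    calc (1 + n : ℝ) ≤ (1 + 4 / δ) * (1 + n * δ / 4) := by
          have e : (1 + 4 / δ) * (1 + n * δ / 4) = 1 + n + (4 / δ + n * δ / 4) := by
            field_simp; ring
          rw [e]
          have : 0 ≤ 4 / δ + n * δ / 4 := by positivity
          linarith
      _ ≤ _ := by gcongr; linarith
  have hL : √(1 + Real.log X) ≤ √(1 + 1 / (2 * p * δ)) * X ^ (p * δ) := by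
    apply Real.sqrt_le_iff.2 ⟨by positivity, ?_⟩
    rw [mul_pow, Real.sq_sqrt (by positivity), ← Real.rpow_natCast, ← Real.rpow_mul hX0.le,
      Real.rpow_def_of_pos hX0]
    have hexp := Real.add_one_le_exp (Real.log X * (p * δ * ((2 : ℕ) : ℝ)))
    calc 1 + Real.log X ≤ (1 + 1 / (2 * p * δ)) * (1 + 2 * p * δ * Real.log X) := by
          have e : (1 + 1 / (2 * p * δ)) * (1 + 2 * p * δ * Real.log X) =
              1 + Real.log X + (1 / (2 * p * δ) + 2 * p * δ * Real.log X) := by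
            field_simp; ring
          rw [e]
          have : 0 ≤ 1 / (2 * p * δ) + 2 * p * δ * Real.log X := by positivity
          linarith
      _ ≤ _ := by
          gcongr
          push_cast at hexp ⊢
          linarith
  set P : ℝ := G * W * √(1 + n) * √(1 + Real.log X) with hP
  have hP1 : 1 ≤ P := by
    have hN1 : 1 ≤ √(1 + (n : ℝ)) := Real.one_le_sqrt.2 (by linarith)
    have hL1 : 1 ≤ √(1 + Real.log X) := Real.one_le_sqrt.2 (by linarith)
    exact one_le_mul_of_one_le_of_one_le (one_le_mul_of_one_le_of_one_le
      (one_le_mul_of_one_le_of_one_le hG hW) hN1) hL1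
  have hCP : 1 ≤ C * P := one_le_mul_of_one_le_of_one_le hC hP1
  have h1δ : 0 ≤ 1 - δ := by linarith
  have e1 : (1 / 2 ^ n : ℝ) = (2 : ℝ) ^ (-(n : ℝ)) := by
    rw [Real.rpow_neg two_pos.le, Real.rpow_natCast, one_div]
  rw [e1] at h1
  calc y = y ^ δ * y ^ (1 - δ) := by
        rw [← Real.rpow_add_of_nonneg hy hδ.le h1δ, add_sub_cancel, Real.rpow_one]
    _ ≤ ((2 : ℝ) ^ (-(n : ℝ))) ^ δ * (C * P * ((2 : ℝ) ^ (-(n : ℝ) / 2) * X ^ (-p))) ^ (1 - δ) :=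
        by gcongr
    _ = (C * P) ^ (1 - δ) * ((2 : ℝ) ^ (-(n : ℝ) * δ + -(n : ℝ) / 2 * (1 - δ)) *
          X ^ (-p * (1 - δ))) := by
        rw [Real.mul_rpow (by positivity) (by positivity),
          Real.mul_rpow (x := 2 ^ (-(n : ℝ) / 2)) (by positivity) (by positivity),
          ← Real.rpow_mul two_pos.le, ← Real.rpow_mul two_pos.le, ← Real.rpow_mul hX0.le,
          Real.rpow_add two_pos]
        ring
    _ ≤ (C * P) * ((2 : ℝ) ^ (-(n : ℝ) * δ + -(n : ℝ) / 2 * (1 - δ)) * X ^ (-p * (1 - δ))) := by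
        gcongr
        exact (Real.rpow_le_rpow_of_exponent_le hCP (by linarith)).trans_eq (Real.rpow_one _)
    _ ≤ (C * (G * W * (√(1 + 4 / δ) * (2 : ℝ) ^ (n * δ / 4)) *
          (√(1 + 1 / (2 * p * δ)) * X ^ (p * δ)))) *
          ((2 : ℝ) ^ (-(n : ℝ) * δ + -(n : ℝ) / 2 * (1 - δ)) * X ^ (-p * (1 - δ))) := by
        rw [hP]; gcongr
    _ = C * √(1 + 4 / δ) * √(1 + 1 / (2 * p * δ)) * G * W *
          (X ^ (p * δ) * X ^ (-p * (1 - δ))) *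
          ((2 : ℝ) ^ (n * δ / 4) * (2 : ℝ) ^ (-(n : ℝ) * δ + -(n : ℝ) / 2 * (1 - δ))) := by ring
    _ = _ := by
        rw [← Real.rpow_add hX0, ← Real.rpow_add two_pos]
        congr 2
        ring

/-- Bound on the averaging constant in terms of `Q^w_λ`: for
`α ∈ (−1/(2H), 1/(2H)]` and `γ = 5/8 + Hα/4 > 1/2` one has
`K^w_{α,γ} ≤ C (1 + Q^w_λ)` with `C = C(H,d,λ,α)`. -/
theorem statement15 (d : ℕ) (hd : 1 ≤ d) (H lam α : ℝ) (hH : 0 < H)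
    (hlam : 0 < lam) (hlam1 : lam ≤ 1)
    (hα : -1 / (2 * H) < α) (hα' : α ≤ 1 / (2 * H))
    (γ : ℝ) (hγ : γ = 5 / 8 + H * α / 4) :
    ∃ C : ℝ, 0 < C ∧ ∀ w : ℝ → Euc d, ContinuousOn w (Set.Icc 0 1) →
      Rconst lam w < ⊤ → Sconst H lam w < ⊤ →
      avgK w α γ ≤ ENNReal.ofReal (C * (1 + Qconst H lam w)) := by
  obtain ⟨C, hC1, hC⟩ := exists_norm_Yint_dyadic_le d hH hlam
  have hHα : -(1 / 2) < H * α := by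
    have := mul_lt_mul_of_pos_left hα hH
    have e : H * (-1 / (2 * H)) = -(1 / 2) := by field_simp
    linarith
  have hHα' : H * α ≤ 1 / 2 := by
    have := mul_le_mul_of_nonneg_left hα' hH.le
    have e : H * (1 / (2 * H)) = 1 / 2 := by field_simp
    linarith
  obtain ⟨δ, hδ⟩ : ∃ δ : ℝ, δ = H * α + 1 / 2 := ⟨_, rfl⟩
  have hδ0 : 0 < δ := by linarith
  have hδ1 : δ ≤ 1 := by linarith
  have hγδ : γ = 1 / 2 + δ / 4 := by linarith
  obtain ⟨p, hp⟩ : ∃ p : ℝ, p = 1 / (2 * H) := ⟨_, rfl⟩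
  have hp0 : 0 < p := by rw [hp]; positivity
  have hαp : p * δ + -p * (1 - δ) = α := by
    rw [hp, hδ]; field_simp; ring
  have hγ0 : 0 < γ := by linarith
  have hr1 : (2 : ℝ) ^ (-γ) < 1 :=
    Real.rpow_lt_one_of_one_lt_of_neg one_lt_two (by linarith)
  have h1r : 0 < 1 - (2 : ℝ) ^ (-γ) := by linarith
  obtain ⟨c₁, hc₁⟩ : ∃ c : ℝ, c = √(1 + 4 / δ) := ⟨_, rfl⟩
  obtain ⟨c₂, hc₂⟩ : ∃ c : ℝ, c = √(1 + 1 / (2 * p * δ)) := ⟨_, rfl⟩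
  have hc₁0 : 0 < c₁ := by rw [hc₁]; positivity
  have hc₂0 : 0 < c₂ := by rw [hc₂]; positivity
  refine ⟨C * c₁ * c₂ * ((1 + 2 / (1 - (2 : ℝ) ^ (-γ))) * 2 ^ γ), by positivity,
    fun w hw _ hS => ?_⟩
  refine iSup_le fun s => iSup_le fun t => iSup_le fun hs => iSup_le fun hst =>
    iSup_le fun ht => iSup_le fun ω => iSup_le fun ξ => ENNReal.ofReal_le_ofReal ?_
  have hX1 : 1 ≤ 1 + ‖ξ‖ := by linarith [norm_nonneg ξ]
  have hX0 : 0 < 1 + ‖ξ‖ := by linarith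
  have hG1 : 1 ≤ 1 + Qconst H lam w := by
    have := Real.sqrt_nonneg (Real.log (Sconst H lam w).toReal)
    have := Real.sqrt_nonneg (Real.log (Rconst lam w).toReal)
    rw [Qconst]; linarith
  have hW1 : 1 ≤ 1 + √(Real.log (1 + |ω|)) := by
    linarith [Real.sqrt_nonneg (Real.log (1 + |ω|))]
  have hts : 0 < t - s := by linarith
  rw [div_le_iff₀ (by positivity)]
  have hdy : ∀ n k : ℕ, k < 2 ^ n →
      ‖Yint w 0 (((k : ℝ) + 1) / 2 ^ n) ω ξ - Yint w 0 ((k : ℝ) / 2 ^ n) ω ξ‖ ≤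
        C * c₁ * c₂ * (1 + Qconst H lam w) * (1 + √(Real.log (1 + |ω|))) * (1 + ‖ξ‖) ^ α *
          ((2 : ℝ) ^ (-γ)) ^ n := by
    intro n k hk
    have hpn : (0 : ℝ) < 2 ^ n := by positivity
    have hk1 : (k : ℝ) + 1 ≤ 2 ^ n := by exact_mod_cast hk
    rw [Yint_sub_Yint hw ω ξ ⟨by positivity, by rw [div_le_one hpn]; linarith⟩
      ⟨by positivity, by rwa [div_le_one hpn]⟩]
    have htriv := norm_Yint_le w ((k : ℝ) / 2 ^ n) (((k : ℝ) + 1) / 2 ^ n) ω ξ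
    rw [← sub_div, add_sub_cancel_left, abs_of_pos (by positivity)] at htriv
    refine (interpolated_decay_le hX1 hp0 hδ0 hδ1 (norm_nonneg _) hC1 hG1 hW1 htriv
      (hp ▸ hC w hw hS n k hk ω ξ)).trans (le_of_eq ?_)
    rw [← hc₁, ← hc₂, hαp, ← hγδ, ← Real.rpow_natCast ((2 : ℝ) ^ (-γ)),
      ← Real.rpow_mul two_pos.le]
  have := norm_sub_le_of_dyadic_increments hγ0 (continuousOn_Yint hw ω ξ) hdy hs hst ht
  rw [Yint_sub_Yint hw ω ξ ⟨hs, by linarith⟩ ⟨by linarith, ht⟩] at this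
  refine this.trans (le_of_eq ?_)
  ring
end
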